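/- arXiv:2509.07145 — 8 statements merged into one kernel-verified Lean document; each statement's English description precedes it below -/
import Mathlib

section
/- In the n-player slack-allocation game with the linear clearing rule, the aggregate payoff satisfies the budget identity: the sum over all players j of π_j equals (the sum over all j of L_j) minus max(I − X, 0). In particular, when scarcity binds (X ≥ I) the rule is budget balanced: the total payoff equals the total entitlement. -/
/-- Overage of player `j`: `v j = max (C j - L j) 0`. -/
noncomputable def overage {n : ℕ} (L C : Fin n → ℝ) (j : Fin n) : ℝ :=
  max (C j - L j) 0

/-- Slack of player `j`: `s j = max (L j - C j) 0`. -/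
noncomputable def slack {n : ℕ} (L C : Fin n → ℝ) (j : Fin n) : ℝ :=
  max (L j - C j) 0

/-- Aggregate overage `X = ∑ j, v j`. -/
noncomputable def totOverage {n : ℕ} (L C : Fin n → ℝ) : ℝ :=
  ∑ j, overage L C j

/-- Aggregate slack `I = ∑ j, s j`. -/
noncomputable def totSlack {n : ℕ} (L C : Fin n → ℝ) : ℝ :=
  ∑ j, slack L C j

/-- Covered overage under the linear clearing rule:
`v̂ j = v j` if `X ≤ I`, and `v̂ j = (I / X) * v j` if `X > I`. -/
noncomputable def covered {n : ℕ} (L C : Fin n → ℝ) (j : Fin n) : ℝ :=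
  if totOverage L C ≤ totSlack L C then overage L C j
  else (totSlack L C / totOverage L C) * overage L C j

/-- Payoff: `π j = C j` if `C j ≤ L j`, and `π j = L j + v̂ j` if `C j > L j`. -/
noncomputable def payoff {n : ℕ} (L C : Fin n → ℝ) (j : Fin n) : ℝ :=
  if C j ≤ L j then C j else L j + covered L C j

theorem totSlack_nonneg {n : ℕ} (L C : Fin n → ℝ) : 0 ≤ totSlack L C :=
  Finset.sum_nonneg fun _ _ => le_max_right _ _

theorem covered_eq_zero {n : ℕ} {L C : Fin n → ℝ} {j : Fin n} (h : C j ≤ L j) :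
    covered L C j = 0 := by
  simp [covered, overage, max_eq_right (sub_nonpos.2 h)]

theorem payoff_eq_sub_slack_add_covered {n : ℕ} (L C : Fin n → ℝ) (j : Fin n) :
    payoff L C j = L j - slack L C j + covered L C j := by
  unfold payoff slack
  split_ifs with h
  · rw [covered_eq_zero h, max_eq_left (sub_nonneg.2 h)]
    ring
  · rw [max_eq_right (by linarith)]
    ring

theorem sum_covered {n : ℕ} (L C : Fin n → ℝ) :
    ∑ j, covered L C j = min (totOverage L C) (totSlack L C) := by
  unfold covered
  split_ifs with h
  · exact (min_eq_left h).symm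
  · rw [← Finset.mul_sum, ← totOverage, min_eq_right (le_of_not_ge h)]
    exact div_mul_cancel₀ _ ((totSlack_nonneg L C).trans_lt (not_le.1 h)).ne'

/-- Budget identity: `∑ j, π j = ∑ j, L j - max (I - X) 0`; in particular,
when scarcity binds (`X ≥ I`) the rule is budget balanced. -/
theorem budget_identity {n : ℕ} (L C : Fin n → ℝ)
    (hL : ∀ j, 0 < L j) (hC : ∀ j, 0 ≤ C j) :
    (∑ j, payoff L C j) =
      (∑ j, L j) - max (totSlack L C - totOverage L C) 0 ∧
    (totSlack L C ≤ totOverage L C → (∑ j, payoff L C j) = ∑ j, L j) := by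
  have key : ∑ j, payoff L C j =
      (∑ j, L j) - totSlack L C + min (totOverage L C) (totSlack L C) := by
    simp only [payoff_eq_sub_slack_add_covered, Finset.sum_add_distrib,
      Finset.sum_sub_distrib, sum_covered, totSlack]
  rw [key]
  grind
end

section
/- In the slack-allocation game with the linear clearing rule and bounded actions C j ∈ [0, M], for any fixed player j and any fixed claims C_{−j} of the other players (each nonnegative), the map sending player j's own claim to their payoff is nondecreasing: for all a, b with 0 ≤ a ≤ b ≤ M, π_j evaluated at the profile where j claims a is less than or equal to π_j evaluated at the profile where j claims b. -/
/-- Above its entitlement, a player's payoff depends on the other players only through their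
aggregate overage `V` and aggregate slack `S`. -/
theorem payoff_update_of_lt {n : ℕ} (L C : Fin n → ℝ) (j : Fin n) {x : ℝ} (hx : L j < x) :
    payoff L (Function.update C j x) j =
      L j + if (x - L j) + ∑ i ∈ Finset.univ.erase j, overage L C i ≤
          ∑ i ∈ Finset.univ.erase j, slack L C i then x - L j
        else (∑ i ∈ Finset.univ.erase j, slack L C i) /
          ((x - L j) + ∑ i ∈ Finset.univ.erase j, overage L C i) * (x - L j) := by
  have hv : overage L (Function.update C j x) j = x - L j := by
    simp [overage, hx.le]
  have hs : slack L (Function.update C j x) j = 0 := by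
    simp [slack, hx.le]
  have hX : totOverage L (Function.update C j x) =
      (x - L j) + ∑ i ∈ Finset.univ.erase j, overage L C i := by
    rw [totOverage, ← Finset.add_sum_erase _ _ (Finset.mem_univ j), hv]
    congr 1
    refine Finset.sum_congr rfl fun i hi => ?_
    rw [overage, overage, Function.update_of_ne (Finset.ne_of_mem_erase hi)]
  have hI : totSlack L (Function.update C j x) = ∑ i ∈ Finset.univ.erase j, slack L C i := by
    rw [totSlack, ← Finset.add_sum_erase _ _ (Finset.mem_univ j), hs, zero_add]
    refine Finset.sum_congr rfl fun i hi => ?_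
    rw [slack, slack, Function.update_of_ne (Finset.ne_of_mem_erase hi)]
  simp only [payoff, covered, hX, hI, hv, Function.update_self, not_le.mpr hx, if_false]

/-- The linear clearing rule is nonnegative. -/
theorem linear_clearing_nonneg {V S t : ℝ} (hV : 0 ≤ V) (hS : 0 ≤ S) (ht : 0 ≤ t) :
    0 ≤ if t + V ≤ S then t else S / (t + V) * t := by
  split_ifs <;> positivity

/-- The linear clearing rule is monotone in the player's own overage. -/
theorem linear_clearing_mono {V S t u : ℝ} (hV : 0 ≤ V) (hS : 0 ≤ S) (ht : 0 < t) (htu : t ≤ u) :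
    (if t + V ≤ S then t else S / (t + V) * t) ≤
      if u + V ≤ S then u else S / (u + V) * u := by
  have htV : 0 < t + V := by linarith
  have huV : 0 < u + V := by linarith
  have hVtu : V * t ≤ V * u := mul_le_mul_of_nonneg_left htu hV
  split_ifs with h₁ h₂ h₂
  · exact htu
  · rw [div_mul_eq_mul_div, le_div_iff₀ huV]
    nlinarith [mul_le_mul_of_nonneg_right h₁ (ht.le.trans htu)]
  · linarith
  · rw [div_mul_eq_mul_div, div_mul_eq_mul_div, div_le_div_iff₀ htV huV]
    nlinarith [mul_le_mul_of_nonneg_left hVtu hS]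

/-- With bounded actions `C j ∈ [0, M]`, for fixed `j` and fixed nonnegative
claims of the others, `x ↦ π_j(x)` is nondecreasing on `[0, M]`. -/
theorem payoff_mono_own_claim {n : ℕ} (M : ℝ) (hM : 0 < M)
    (L C : Fin n → ℝ) (hL : ∀ i, 0 < L i) (j : Fin n)
    (hC : ∀ i, i ≠ j → 0 ≤ C i) :
    ∀ a b : ℝ, 0 ≤ a → a ≤ b → b ≤ M →
      payoff L (Function.update C j a) j ≤ payoff L (Function.update C j b) j := by
  intro a b _ hab _
  have hV : 0 ≤ ∑ i ∈ Finset.univ.erase j, overage L C i :=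
    Finset.sum_nonneg fun i _ => le_max_right _ _
  have hS : 0 ≤ ∑ i ∈ Finset.univ.erase j, slack L C i :=
    Finset.sum_nonneg fun i _ => le_max_right _ _
  have payoff_of_le {x : ℝ} (hx : x ≤ L j) : payoff L (Function.update C j x) j = x := by
    simp [payoff, hx]
  rcases le_or_gt b (L j) with hb | hb
  · rw [payoff_of_le hb, payoff_of_le (hab.trans hb)]
    exact hab
  rw [payoff_update_of_lt L C j hb]
  rcases le_or_gt a (L j) with ha | ha
  · rw [payoff_of_le ha]
    have := linear_clearing_nonneg hV hS (sub_pos.mpr hb).le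
    linarith
  · rw [payoff_update_of_lt L C j ha]
    gcongr
    exact linear_clearing_mono hV hS (sub_pos.mpr ha) (sub_le_sub_right hab _)
end

section
/- Let n ≥ 2 and α > 0. The proportionality identity (v j)^α / (∑_m (v m)^α) = v j / (∑_m v m) holds for every vector v : Fin n → ℝ with v j > 0 for all j and every index j if and only if α = 1. (This is the algebraic content of the uniqueness of boundary continuity: within the α-power family, the two branches of the clearing rule agree at the boundary X = I for all positive overage vectors iff α = 1.) -/
/-- Within the α-power family, the proportionality identity
`(v j)^α / ∑ m, (v m)^α = v j / ∑ m, v m` holds for every positive vector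
`v` and every index `j` if and only if `α = 1` (uniqueness of boundary
continuity at `X = I`). -/
theorem alpha_power_proportionality_iff {n : ℕ} (hn : 2 ≤ n)
    (α : ℝ) (hα : 0 < α) :
    (∀ v : Fin n → ℝ, (∀ j, 0 < v j) →
        ∀ j, (v j) ^ α / (∑ m, (v m) ^ α) = v j / (∑ m, v m)) ↔ α = 1 := by
  constructor
  · intro h
    let i : Fin n := ⟨0, by omega⟩
    let k : Fin n := ⟨1, by omega⟩
    have hki : k ≠ i := by simp [i, k, Fin.ext_iff]
    let v : Fin n → ℝ := fun j => if j = i then 2 else 1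
    have hv : ∀ j, 0 < v j := by
      intro j
      by_cases hj : j = i <;> simp [v, hj]
    have hvi : v i = 2 := by simp [v]
    have hvk : v k = 1 := by simp [v, hki]
    have hT : 0 < ∑ m, v m := Finset.sum_pos (fun m _ => hv m) ⟨i, Finset.mem_univ i⟩
    have hi := h v hv i
    have hk := h v hv k
    rw [hvk, Real.one_rpow, one_div, one_div, inv_inj] at hk
    rw [hk, hvi, div_left_inj' hT.ne'] at hi
    have hpow : (2 : ℝ) ^ α = 2 ^ (1 : ℝ) := by rw [hi, Real.rpow_one]
    exact (Real.rpow_right_inj two_pos (by norm_num)).mp hpow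
  · rintro rfl v _ j
    simp only [Real.rpow_one]
end

section
/- Let n ≥ 2, α > 0 with α ≠ 1, and let v : Fin n → ℝ satisfy v j > 0 for all j. Then the proportionality identity (v j)^α / (∑_m (v m)^α) = v j / (∑_m v m) holds for every index j if and only if v is constant (all entries equal). Hence for α ≠ 1 the α-power clearing rule has a jump at the boundary X = I except on the set of overage vectors with all positive entries equal. -/
/-- For `α ≠ 1`, the proportionality identity
`(v j)^α / ∑ m, (v m)^α = v j / ∑ m, v m` holds for every index `j` if and
only if the positive vector `v` is constant; hence for `α ≠ 1` the α-power
rule jumps at the boundary `X = I` except when all positive overages are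
equal. -/
theorem alpha_power_proportionality_iff_const {n : ℕ} (hn : 2 ≤ n)
    (α : ℝ) (hα : 0 < α) (hα1 : α ≠ 1)
    (v : Fin n → ℝ) (hv : ∀ j, 0 < v j) :
    (∀ j, (v j) ^ α / (∑ m, (v m) ^ α) = v j / (∑ m, v m)) ↔
      (∀ i j, v i = v j) := by
  have : NeZero n := ⟨by omega⟩
  have hS : 0 < ∑ m, v m := Finset.sum_pos (fun m _ => hv m) Finset.univ_nonempty
  have hT : 0 < ∑ m, (v m) ^ α :=
    Finset.sum_pos (fun m _ => Real.rpow_pos_of_pos (hv m) α) Finset.univ_nonempty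
  constructor
  · intro h i j
    have key : ∀ k, (v k) ^ (α - 1) = (∑ m, (v m) ^ α) / ∑ m, v m := by
      intro k
      have hk := h k
      rw [div_eq_div_iff hT.ne' hS.ne'] at hk
      rw [Real.rpow_sub_one (hv k).ne', div_eq_div_iff (hv k).ne' hS.ne', hk, mul_comm]
    exact Real.rpow_left_injOn (sub_ne_zero.mpr hα1) (hv i).le (hv j).le
      ((key i).trans (key j).symm)
  · intro h j
    have hpow : (v j) ^ α ≠ 0 := (Real.rpow_pos_of_pos (hv j) α).ne'
    have hj : v j ≠ 0 := (hv j).ne'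
    have hn0 : (n : ℝ) ≠ 0 := NeZero.ne _
    simp only [h _ j, Finset.sum_const, Finset.card_univ, Fintype.card_fin, nsmul_eq_mul]
    field_simp
end

section
/- In the slack-allocation game with the linear clearing rule, suppose the complement of the coalition K defects, i.e., C j > L j for every player j not in K, and suppose X ≤ I. Then the coalition's aggregate payoff is bounded by its aggregate entitlement: ∑_{i ∈ K} π i ≤ ∑_{i ∈ K} L i. -/
/-- When the aggregate slack covers the aggregate overage, every player receives their claim. -/
theorem payoff_eq_claim {n : ℕ} {L C : Fin n → ℝ}
    (hXI : totOverage L C ≤ totSlack L C) (j : Fin n) : payoff L C j = C j := by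
  unfold payoff covered overage
  split_ifs with h
  · rfl
  · rw [max_eq_left (by linarith)]
    ring

/-- The total excess of claims over entitlements is the aggregate overage minus the
aggregate slack. -/
theorem sum_claim_sub_entitlement {n : ℕ} (L C : Fin n → ℝ) :
    ∑ j, (C j - L j) = totOverage L C - totSlack L C := by
  unfold totOverage totSlack
  rw [← Finset.sum_sub_distrib]
  refine Finset.sum_congr rfl fun j _ => ?_
  unfold overage slack
  rcases le_total (C j) (L j) with h | h
  · rw [max_eq_right (by linarith), max_eq_left (by linarith)]
    ring
  · rw [max_eq_left (by linarith), max_eq_right (by linarith)]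
    ring

/-- If the complement of coalition `K` defects and `X ≤ I`, then the
coalition's aggregate payoff is at most its aggregate entitlement. -/
theorem coalition_bound_slack_region {n : ℕ} (L C : Fin n → ℝ)
    (hL : ∀ j, 0 < L j) (hC : ∀ j, 0 ≤ C j) (K : Finset (Fin n))
    (hdef : ∀ j, j ∉ K → L j < C j)
    (hXI : totOverage L C ≤ totSlack L C) :
    (∑ i ∈ K, payoff L C i) ≤ ∑ i ∈ K, L i := by
  rw [Finset.sum_congr rfl fun i _ => payoff_eq_claim hXI i, ← sub_nonpos,
    ← Finset.sum_sub_distrib]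
  calc ∑ i ∈ K, (C i - L i) ≤ ∑ i, (C i - L i) :=
        Finset.sum_le_sum_of_subset_of_nonneg (Finset.subset_univ K)
          fun i _ hi => (sub_pos.mpr (hdef i hi)).le
    _ = totOverage L C - totSlack L C := sum_claim_sub_entitlement L C
    _ ≤ 0 := sub_nonpos.mpr hXI
end

section
/- In the slack-allocation game with the linear clearing rule, suppose the complement of the coalition K defects, i.e., C j > L j for every player j not in K, and suppose X > I. Let X_K = ∑_{i ∈ K} v i and X_{−K} = X − X_K. Then the coalition's aggregate payoff satisfies the exact identity ∑_{i ∈ K} π i = ∑_{i ∈ K} L i − I · X_{−K} / X, and in particular ∑_{i ∈ K} π i ≤ ∑_{i ∈ K} L i. -/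
/-- A coalition's overage is at most the total overage. -/
theorem sum_overage_le_totOverage {n : ℕ} (L C : Fin n → ℝ) (K : Finset (Fin n)) :
    ∑ i ∈ K, overage L C i ≤ totOverage L C :=
  Finset.sum_le_sum_of_subset_of_nonneg (Finset.subset_univ K) fun _ _ _ => le_max_right _ _

/-- If everyone outside `K` defects, then `K` provides all of the slack. -/
theorem sum_slack_eq_totSlack {n : ℕ} (L C : Fin n → ℝ) (K : Finset (Fin n))
    (hdef : ∀ j, j ∉ K → L j < C j) : ∑ i ∈ K, slack L C i = totSlack L C :=
  Finset.sum_subset (Finset.subset_univ K) fun j _ hj =>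
    max_eq_right (sub_nonpos.2 (hdef j hj).le)

/-- Under scarcity, a payoff is the entitlement minus the slack plus the covered overage. -/
theorem payoff_eq_of_totSlack_lt {n : ℕ} (L C : Fin n → ℝ)
    (hXI : totSlack L C < totOverage L C) (j : Fin n) :
    payoff L C j =
      L j - slack L C j + totSlack L C / totOverage L C * overage L C j := by
  unfold payoff covered
  rw [if_neg hXI.not_ge]
  split_ifs with h
  · have hs : slack L C j = L j - C j := max_eq_left (sub_nonneg.2 h)
    have hv : overage L C j = 0 := max_eq_right (sub_nonpos.2 h)
    rw [hs, hv]
    ring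
  · have hs : slack L C j = 0 := max_eq_right (sub_nonpos.2 (not_le.1 h).le)
    rw [hs, sub_zero]

/-- If the complement of coalition `K` defects and `X > I`, then with
`X_K = ∑_{i∈K} v i` and `X_{-K} = X - X_K`, the coalition's aggregate payoff
satisfies `∑_{i∈K} π i = ∑_{i∈K} L i - I · X_{-K} / X ≤ ∑_{i∈K} L i`. -/
theorem coalition_identity_scarcity_region {n : ℕ} (L C : Fin n → ℝ)
    (hL : ∀ j, 0 < L j) (hC : ∀ j, 0 ≤ C j) (K : Finset (Fin n))
    (hdef : ∀ j, j ∉ K → L j < C j)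
    (hXI : totSlack L C < totOverage L C) :
    (∑ i ∈ K, payoff L C i) =
      (∑ i ∈ K, L i) -
        totSlack L C * (totOverage L C - ∑ i ∈ K, overage L C i) / totOverage L C ∧
    (∑ i ∈ K, payoff L C i) ≤ ∑ i ∈ K, L i := by
  have hI := totSlack_nonneg L C
  have hX : 0 < totOverage L C := hI.trans_lt hXI
  have key : (∑ i ∈ K, payoff L C i) =
      (∑ i ∈ K, L i) -
        totSlack L C * (totOverage L C - ∑ i ∈ K, overage L C i) / totOverage L C := by
    simp only [payoff_eq_of_totSlack_lt L C hXI]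
    rw [Finset.sum_add_distrib, Finset.sum_sub_distrib, ← Finset.mul_sum,
      sum_slack_eq_totSlack L C K hdef]
    field_simp
    ring
  refine ⟨key, key.trans_le (sub_le_self _ ?_)⟩
  exact div_nonneg (mul_nonneg hI (sub_nonneg.2 (sum_overage_le_totOverage L C K))) hX.le
end

section
/- In the slack-allocation game with the linear clearing rule, the cooperative profile C = L is a Nash equilibrium: for every player j and every unilateral deviation a ≥ 0 (the other players claiming exactly their entitlements L_{−j}), player j's payoff at the deviated profile is at most L j, and it equals L j when a = L j. -/
theorem totSlack_eq_zero {n : ℕ} {L C : Fin n → ℝ} (h : ∀ k, L k ≤ C k) :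
    totSlack L C = 0 :=
  Finset.sum_eq_zero fun k _ => max_eq_right (sub_nonpos.2 (h k))

theorem overage_le_totOverage {n : ℕ} (L C : Fin n → ℝ) (j : Fin n) :
    overage L C j ≤ totOverage L C :=
  Finset.single_le_sum (f := overage L C) (fun _ _ => le_max_right _ _) (Finset.mem_univ j)

/-- Without any slack, no overage is covered. -/
theorem covered_nonpos_of_totSlack_eq_zero {n : ℕ} {L C : Fin n → ℝ}
    (h : totSlack L C = 0) (j : Fin n) : covered L C j ≤ 0 := by
  unfold covered
  split_ifs with hX
  · exact (overage_le_totOverage L C j).trans (hX.trans h.le)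
  · simp [h]

/-- The cooperative profile `C = L` is a Nash equilibrium: for every player
`j` and every unilateral deviation `a ≥ 0` (others claiming their
entitlements), `j`'s payoff is at most `L j`, with equality at `a = L j`. -/
theorem cooperative_profile_nash {n : ℕ} (L : Fin n → ℝ) (hL : ∀ j, 0 < L j)
    (j : Fin n) :
    (∀ a : ℝ, 0 ≤ a → payoff L (Function.update L j a) j ≤ L j) ∧
    payoff L (Function.update L j (L j)) j = L j := by
  refine ⟨fun a _ => ?_, by simp [payoff]⟩
  unfold payoff
  split_ifs with h
  · exact h
  · rw [Function.update_self, not_le] at h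
    have hle : ∀ k, L k ≤ Function.update L j a k :=
      le_update_self_iff.2 h.le
    linarith [covered_nonpos_of_totSlack_eq_zero (totSlack_eq_zero hle) j]
end

section
/- In the α-power slack-allocation family, for every α > 0 the aggregate payoff satisfies the same budget identity as the linear rule: ∑_j π^α j = ∑_j L j − max(I − X, 0). In particular, in the scarcity region X ≥ I the total payoff equals the total entitlement, and in the slack region X < I it equals the total entitlement minus (I − X). -/
open scoped Classical in
/-- Covered overage under the α-power clearing rule: `v̂^α j = v j` if
`X ≤ I`, and `v̂^α j = I · (v j)^α / ∑_{m : v m > 0} (v m)^α` if `X > I`. -/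
noncomputable def coveredA {n : ℕ} (α : ℝ) (L C : Fin n → ℝ) (j : Fin n) : ℝ :=
  if totOverage L C ≤ totSlack L C then overage L C j
  else totSlack L C * (overage L C j) ^ α /
    ∑ m ∈ Finset.univ.filter (fun m => 0 < overage L C m), (overage L C m) ^ α

/-- α-power payoff: `π^α j = C j` if `C j ≤ L j`, else `L j + v̂^α j`. -/
noncomputable def payoffA {n : ℕ} (α : ℝ) (L C : Fin n → ℝ) (j : Fin n) : ℝ :=
  if C j ≤ L j then C j else L j + coveredA α L C j

section CoveredOverage

variable {n : ℕ} {α : ℝ} {L C : Fin n → ℝ}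

lemma coveredA_eq_zero (hα : α ≠ 0) {j : Fin n} (hj : overage L C j = 0) :
    coveredA α L C j = 0 := by
  simp [coveredA, hj, Real.zero_rpow hα]

lemma payoffA_eq_sub_slack_add_coveredA (hα : α ≠ 0) (j : Fin n) :
    payoffA α L C j = L j - slack L C j + coveredA α L C j := by
  unfold payoffA
  split_ifs with h
  · rw [coveredA_eq_zero hα (max_eq_right (by linarith)), slack, max_eq_left (by linarith)]
    ring
  · rw [slack, max_eq_right (by linarith), sub_zero]

open scoped Classical in
lemma sum_filter_overage_rpow (hα : α ≠ 0) :
    ∑ j ∈ Finset.univ.filter (fun j => 0 < overage L C j), overage L C j ^ α =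
      ∑ j, overage L C j ^ α := by
  refine Finset.sum_filter_of_ne fun j _ hj => ?_
  refine (le_max_right (C j - L j) 0).lt_of_ne' fun h => hj ?_
  rw [overage, h, Real.zero_rpow hα]

lemma sum_coveredA (hα : α ≠ 0) :
    ∑ j, coveredA α L C j = min (totOverage L C) (totSlack L C) := by
  have hv : ∀ j, 0 ≤ overage L C j := fun j => le_max_right _ _
  rcases le_or_gt (totOverage L C) (totSlack L C) with h | h
  · simp only [coveredA, if_pos h, min_eq_left h]
    rfl
  · have hI : 0 ≤ totSlack L C := Finset.sum_nonneg fun j _ => le_max_right _ _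
    obtain ⟨i, -, hi⟩ := Finset.exists_lt_of_sum_lt (s := Finset.univ)
      (f := fun _ : Fin n => (0 : ℝ)) (g := overage L C)
      (Finset.sum_const_zero.trans_lt (hI.trans_lt h))
    have hpos : 0 < ∑ j, overage L C j ^ α :=
      Finset.sum_pos' (fun j _ => Real.rpow_nonneg (hv j) α)
        ⟨i, Finset.mem_univ i, Real.rpow_pos_of_pos hi α⟩
    simp only [coveredA, if_neg h.not_ge, sum_filter_overage_rpow hα]
    rw [← Finset.sum_div, ← Finset.mul_sum, mul_div_cancel_right₀ _ hpos.ne',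
      min_eq_right h.le]

end CoveredOverage

/-- For every `α > 0`, the α-power family satisfies the budget identity
`∑ j, π^α j = ∑ j, L j - max (I - X) 0`; in particular the total payoff is the
total entitlement in the scarcity region `X ≥ I`, and the total entitlement
minus `(I - X)` in the slack region `X < I`. -/
theorem alpha_budget_identity {n : ℕ} (α : ℝ) (hα : 0 < α)
    (L C : Fin n → ℝ) (hL : ∀ j, 0 < L j) (hC : ∀ j, 0 ≤ C j) :
    (∑ j, payoffA α L C j) =
      (∑ j, L j) - max (totSlack L C - totOverage L C) 0 ∧
    (totSlack L C ≤ totOverage L C →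
      (∑ j, payoffA α L C j) = ∑ j, L j) ∧
    (totOverage L C < totSlack L C →
      (∑ j, payoffA α L C j) = (∑ j, L j) - (totSlack L C - totOverage L C)) := by
  have budget : ∑ j, payoffA α L C j =
      (∑ j, L j) - max (totSlack L C - totOverage L C) 0 := by
    simp only [payoffA_eq_sub_slack_add_coveredA hα.ne', Finset.sum_add_distrib,
      Finset.sum_sub_distrib, sum_coveredA hα.ne']
    change _ - totSlack L C + _ = _
    grind
  refine ⟨budget, fun h => ?_, fun h => ?_⟩
  · rw [budget, max_eq_right (by linarith), sub_zero]
  · rw [budget, max_eq_left (by linarith)]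
end
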